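/- Let λ denote Lebesgue measure and μ₂ = ½·λ|_{[0,2]}; set aₙ = ½(Σ_{i=1}^{n−1} 1/i² + Σ_{i=1}^{n} 1/i²) for n ≥ 1, ā = π²/12 + 1, Iₙ = [Σ_{i=1}^{n−1} 1/i², Σ_{i=1}^{n} 1/i²], Ī = [π²/6, 2], μ₁ = ½·Σ_{n=1}^∞ (1/n²)·δ_{aₙ} + ½·(2 − π²/6)·δ_{ā}, and Q = ½·Σ_{n=1}^∞ δ_{aₙ} ⊗ λ|_{Iₙ} + ½·δ_{ā} ⊗ λ|_{Ī} (the unique element of M(μ₁,μ₂)). Then there do not exist functions u₁, u₂, Δ : ℝ → ℝ such that u₁(s₁) + u₂(s₂) + Δ(s₁)(s₂ − s₁) ≤ −|s₂ − s₁| for all (s₁,s₂) ∈ ℝ² and u₁(s₁) + u₂(s₂) + Δ(s₁)(s₂ − s₁) = −|s₂ − s₁| for Q-almost all (s₁,s₂). In particular, for the payoff Φ(s₁,s₂) = −|s₂ − s₁| the dual value D is finite but the dual supremum is not attained. -/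

import Mathlib

open MeasureTheory
open scoped BigOperators ENNReal

noncomputable section

namespace MOT2

/-- `Q ∈ M(μ₁, μ₂)`: `Q` is a Borel probability measure on `ℝ²` with marginals `μ₁, μ₂`
under which the coordinate process `(S₁, S₂)` is a martingale, i.e.
`∫ Δ(s₁)(s₂ - s₁) dQ = 0` for every bounded measurable `Δ : ℝ → ℝ`. -/
def IsMartingaleCoupling (Q : Measure (ℝ × ℝ)) (μ₁ μ₂ : Measure ℝ) : Prop :=
  IsProbabilityMeasure Q ∧ Q.map Prod.fst = μ₁ ∧ Q.map Prod.snd = μ₂ ∧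
    ∀ Δ : ℝ → ℝ, Measurable Δ → (∃ C, ∀ x, |Δ x| ≤ C) →
      ∫ p : ℝ × ℝ, Δ p.1 * (p.2 - p.1) ∂Q = 0

end MOT2

namespace CounterEx

/-- `S n = ∑_{i=1}^{n} 1/i²` (partial sums of the Basel series). -/
noncomputable def S (n : ℕ) : ℝ := ∑ i ∈ Finset.range n, (1 : ℝ) / ((i : ℝ) + 1) ^ 2

/-- `a (n)` is the midpoint `aₙ₊₁ = ½ (∑_{i=1}^{n} 1/i² + ∑_{i=1}^{n+1} 1/i²)` of the
interval `Iₙ₊₁`. -/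
noncomputable def a (n : ℕ) : ℝ := (S n + S (n + 1)) / 2

/-- `ā = π²/12 + 1`, the midpoint of `Ī = [π²/6, 2]`. -/
noncomputable def abar : ℝ := Real.pi ^ 2 / 12 + 1

/-- `μ₁ = ½ ∑_{n≥1} (1/n²) δ_{aₙ} + ½ (2 - π²/6) δ_{ā}`. -/
noncomputable def μ₁ : Measure ℝ :=
  Measure.sum (fun n : ℕ =>
      ENNReal.ofReal ((1 / 2 : ℝ) * (1 / ((n : ℝ) + 1) ^ 2)) • Measure.dirac (a n)) +
    ENNReal.ofReal ((1 / 2 : ℝ) * (2 - Real.pi ^ 2 / 6)) • Measure.dirac abar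

/-- `μ₂ = ½ λ|_{[0,2]}`, the uniform distribution on `[0, 2]`. -/
noncomputable def μ₂ : Measure ℝ :=
  ENNReal.ofReal (1 / 2 : ℝ) • volume.restrict (Set.Icc (0 : ℝ) 2)

/-- `Q = ½ ∑_{n≥1} δ_{aₙ} ⊗ λ|_{Iₙ} + ½ δ_{ā} ⊗ λ|_{Ī}`. -/
noncomputable def Q : Measure (ℝ × ℝ) :=
  ENNReal.ofReal (1 / 2 : ℝ) •
      Measure.sum (fun n : ℕ =>
        (Measure.dirac (a n)).prod (volume.restrict (Set.Icc (S n) (S (n + 1))))) +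
    ENNReal.ofReal (1 / 2 : ℝ) •
      (Measure.dirac abar).prod (volume.restrict (Set.Icc (Real.pi ^ 2 / 6) 2))

end CounterEx

namespace CounterEx

lemma S_succ (n : ℕ) : S (n + 1) = S n + 1 / ((n : ℝ) + 1) ^ 2 := by
  simp [S, Finset.sum_range_succ]

lemma S_lt_succ (n : ℕ) : S n < S (n + 1) := by
  rw [S_succ]
  have : (0 : ℝ) < 1 / ((n : ℝ) + 1) ^ 2 := by positivity
  linarith

lemma S_strictMono : StrictMono S := strictMono_nat_of_lt_succ S_lt_succ

lemma S_zero : S 0 = 0 := by simp [S]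

lemma S_nonneg (n : ℕ) : 0 ≤ S n := by
  rw [← S_zero]
  exact S_strictMono.monotone (Nat.zero_le n)

lemma tendsto_S : Filter.Tendsto S Filter.atTop (nhds (Real.pi ^ 2 / 6)) := by
  have h := (hasSum_nat_add_iff' 1).2 hasSum_zeta_two
  simpa [funext fun n => S.eq_1 n] using h.tendsto_sum_nat

lemma S_lt_limit (n : ℕ) : S n < Real.pi ^ 2 / 6 :=
  (S_lt_succ n).trans_le (S_strictMono.monotone.ge_of_tendsto tendsto_S _)

lemma limit_lt_two : Real.pi ^ 2 / 6 < 2 := by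
  nlinarith [Real.pi_lt_d2, Real.pi_pos]

lemma S_lt_a (n : ℕ) : S n < a n := by
  have := S_lt_succ n
  unfold a
  linarith

lemma a_lt_S (n : ℕ) : a n < S (n + 1) := by
  have := S_lt_succ n
  unfold a
  linarith

lemma a_strictMono : StrictMono a :=
  strictMono_nat_of_lt_succ fun n => (a_lt_S n).trans (S_lt_a (n + 1))

lemma a_lt_limit (n : ℕ) : a n < Real.pi ^ 2 / 6 := (a_lt_S n).trans (S_lt_limit _)

lemma limit_lt_abar : Real.pi ^ 2 / 6 < abar := by
  have := limit_lt_two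
  unfold abar
  linarith

lemma abar_lt_two : abar < 2 := by
  have := limit_lt_two
  unfold abar
  linarith

lemma ae_Q_iff {P : ℝ × ℝ → Prop} :
    (∀ᵐ p ∂Q, P p) ↔
      (∀ n, ∀ᵐ s ∂(volume.restrict (Set.Icc (S n) (S (n + 1)))), P (a n, s)) ∧
        ∀ᵐ s ∂(volume.restrict (Set.Icc (Real.pi ^ 2 / 6) 2)), P (abar, s) := by
  have h : ENNReal.ofReal (1 / 2 : ℝ) ≠ 0 := by simp
  simp only [Q, ae_add_measure_iff, Measure.ae_ennreal_smul_measure_iff h, Measure.ae_sum_iff,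
    Measure.dirac_prod, (measurableEmbedding_prodMk_left _).ae_map_iff]

lemma ae_Q_of_forall {P : ℝ × ℝ → Prop}
    (h : ∀ n, ∀ s ∈ Set.Icc (S n) (S (n + 1)), P (a n, s))
    (hbar : ∀ s ∈ Set.Icc (Real.pi ^ 2 / 6) 2, P (abar, s)) : ∀ᵐ p ∂Q, P p :=
  ae_Q_iff.2 ⟨fun n => ae_restrict_of_forall_mem measurableSet_Icc (h n),
    ae_restrict_of_forall_mem measurableSet_Icc hbar⟩

lemma ae_Q_mem_Icc : ∀ᵐ p ∂Q, p.1 ∈ Set.Icc (0 : ℝ) 2 ∧ p.2 ∈ Set.Icc (0 : ℝ) 2 := by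
  have h2 := limit_lt_two
  refine ae_Q_of_forall (fun n s hs => ?_) (fun s hs => ?_)
  · have h0 := S_nonneg n
    have h1 := S_lt_a n
    have h3 := a_lt_limit n
    have h4 := S_lt_limit (n + 1)
    exact ⟨⟨by linarith, by linarith⟩, ⟨by linarith [hs.1], by linarith [hs.2]⟩⟩
  · have h1 := limit_lt_abar
    have h3 := abar_lt_two
    have h4 : 0 ≤ Real.pi ^ 2 / 6 := by positivity
    exact ⟨⟨by linarith, by linarith⟩, ⟨by linarith [hs.1], by linarith [hs.2]⟩⟩

lemma iUnion_Ico_S : ⋃ n, Set.Ico (S n) (S (n + 1)) = Set.Ico 0 (Real.pi ^ 2 / 6) := by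
  ext x
  simp only [Set.mem_iUnion, Set.mem_Ico]
  constructor
  · rintro ⟨n, h1, h2⟩
    exact ⟨(S_nonneg n).trans h1, h2.trans (S_lt_limit _)⟩
  · rintro ⟨h0, h1⟩
    classical
    have hex : ∃ n, x < S n := (tendsto_S.eventually_const_lt h1).exists
    have hpos : Nat.find hex ≠ 0 := by
      intro h
      have := Nat.find_spec hex
      rw [h, S_zero] at this
      linarith
    obtain ⟨m, hm⟩ := Nat.exists_eq_succ_of_ne_zero hpos
    refine ⟨m, not_lt.1 (Nat.find_min hex (by omega)), ?_⟩
    have := Nat.find_spec hex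
    rwa [hm] at this

lemma sum_restrict_Icc_S :
    Measure.sum (fun n => (volume : Measure ℝ).restrict (Set.Icc (S n) (S (n + 1)))) =
      volume.restrict (Set.Ico 0 (Real.pi ^ 2 / 6)) := by
  simp_rw [← restrict_Ico_eq_restrict_Icc]
  rw [← iUnion_Ico_S, Measure.restrict_iUnion _ fun _ => measurableSet_Ico]
  simpa using S_strictMono.monotone.pairwise_disjoint_on_Ico_succ

lemma smul_measure_sum {α ι : Type*} [MeasurableSpace α] (c : ℝ≥0∞) (μ : ι → Measure α) :
    c • Measure.sum μ = Measure.sum fun i => c • μ i := by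
  ext s hs
  simp [Measure.sum_apply _ hs, ENNReal.tsum_mul_left]

lemma map_fst_Q : Q.map Prod.fst = μ₁ := by
  have hfst : Measurable (Prod.fst : ℝ × ℝ → ℝ) := measurable_fst
  rw [Q, μ₁, Measure.map_add _ _ hfst, Measure.map_smul, Measure.map_smul,
    Measure.map_sum hfst.aemeasurable, smul_measure_sum]
  simp only [Measure.map_fst_prod, Measure.restrict_apply_univ, Real.volume_Icc, smul_smul,
    ← ENNReal.ofReal_mul (show (0 : ℝ) ≤ 1 / 2 by norm_num), S_succ, add_sub_cancel_left]

lemma map_snd_Q : Q.map Prod.snd = μ₂ := by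
  have hsnd : Measurable (Prod.snd : ℝ × ℝ → ℝ) := measurable_snd
  rw [Q, μ₂, Measure.map_add _ _ hsnd, Measure.map_smul, Measure.map_smul,
    Measure.map_sum hsnd.aemeasurable]
  simp only [Measure.map_snd_prod, measure_univ, one_smul]
  rw [sum_restrict_Icc_S, ← smul_add, ← Measure.restrict_union _ measurableSet_Icc,
    Set.Ico_union_Icc_eq_Icc (by positivity) limit_lt_two.le]
  rw [Set.disjoint_left]
  intro x hx hx'
  exact absurd hx.2 (not_lt.2 hx'.1)

lemma isProbabilityMeasure_Q : IsProbabilityMeasure Q := by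
  have h : IsProbabilityMeasure (Q.map Prod.snd) := by
    rw [map_snd_Q]
    constructor
    simp only [μ₂, Measure.smul_apply, Measure.restrict_apply_univ, Real.volume_Icc, smul_eq_mul]
    rw [← ENNReal.ofReal_mul (by norm_num)]
    norm_num
  exact Measure.isProbabilityMeasure_of_map Prod.snd

lemma integrable_Q_mul_sub {Δ : ℝ → ℝ} (hΔ : Measurable Δ) (hb : ∃ C, ∀ x, |Δ x| ≤ C) :
    Integrable (fun p : ℝ × ℝ => Δ p.1 * (p.2 - p.1)) Q := by
  have := isProbabilityMeasure_Q
  obtain ⟨C, hC⟩ := hb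
  refine Integrable.of_bound (by fun_prop) (C * 2) ?_
  filter_upwards [ae_Q_mem_Icc] with p hp
  rw [Real.norm_eq_abs, abs_mul]
  refine mul_le_mul (hC _) ?_ (abs_nonneg _) ((abs_nonneg _).trans (hC 0))
  rw [abs_le]
  exact ⟨by linarith [hp.1.2, hp.2.1], by linarith [hp.1.1, hp.2.2]⟩

lemma integral_dirac_prod_mul_sub (Δ : ℝ → ℝ) {x y m : ℝ} (hxy : x ≤ y) (hm : m = (x + y) / 2) :
    ∫ p : ℝ × ℝ, Δ p.1 * (p.2 - p.1)
      ∂((Measure.dirac m).prod (volume.restrict (Set.Icc x y))) = 0 := by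
  rw [Measure.dirac_prod, (measurableEmbedding_prodMk_left m).integral_map]
  dsimp only
  rw [integral_const_mul,
    integral_Icc_eq_integral_Ioc, ← intervalIntegral.integral_of_le hxy]
  have : ∫ s in x..y, (s - m) = 0 := by
    rw [intervalIntegral.integral_sub (by simp) (by simp), integral_id,
      intervalIntegral.integral_const, smul_eq_mul, hm]
    ring
  rw [this, mul_zero]

lemma isMartingaleCoupling_Q : MOT2.IsMartingaleCoupling Q μ₁ μ₂ := by
  refine ⟨isProbabilityMeasure_Q, map_fst_Q, map_snd_Q, fun Δ hΔ hb => ?_⟩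
  have hQ := integrable_Q_mul_sub hΔ hb
  have h0 : ENNReal.ofReal (1 / 2 : ℝ) ≠ 0 := by simp
  have hQ' := hQ
  rw [Q, integrable_add_measure, integrable_smul_measure h0 ENNReal.ofReal_ne_top,
    integrable_smul_measure h0 ENNReal.ofReal_ne_top] at hQ'
  rw [Q, integral_add_measure (hQ'.1.smul_measure ENNReal.ofReal_ne_top)
    (hQ'.2.smul_measure ENNReal.ofReal_ne_top), integral_smul_measure, integral_smul_measure,
    integral_sum_measure hQ'.1, integral_dirac_prod_mul_sub Δ limit_lt_two.le
      (by unfold abar; ring)]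
  simp [integral_dirac_prod_mul_sub Δ (S_lt_succ _).le (show a _ = _ from rfl)]

end CounterEx

namespace CounterEx

theorem not_exists_pointwise_optimizer :
    ¬ ∃ u₁ u₂ Δ : ℝ → ℝ,
        (∀ s₁ s₂ : ℝ, u₁ s₁ + u₂ s₂ + Δ s₁ * (s₂ - s₁) ≤ -|s₂ - s₁|) ∧
        (∀ᵐ p : ℝ × ℝ ∂Q, u₁ p.1 + u₂ p.2 + Δ p.1 * (p.2 - p.1) = -|p.2 - p.1|) := by
  rintro ⟨u₁, u₂, Δ, hle, heq⟩
  set f : ℕ → ℝ → ℝ := fun n s => -|s - a n| - u₁ (a n) - Δ (a n) * (s - a n) with hf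
  have hu : ∀ n s, u₂ s ≤ f n s := fun n s => by
    have := hle (a n) s
    simp only [hf]
    linarith
  have hcont : ∀ n, Continuous (f n) := fun n => by fun_prop
  have hmin : ∀ n m, ∀ s ∈ Set.Icc (S n) (S (n + 1)), f n s ≤ f m s := by
    intro n m s hs
    have hae : f n =ᵐ[volume.restrict (Set.Icc (S n) (S (n + 1)))]
        fun s => min (f n s) (f m s) := by
      filter_upwards [(ae_Q_iff.1 heq).1 n] with s hs
      have h1 : f n s = u₂ s := by
        simp only [hf]
        linarith
      rw [min_eq_left (h1 ▸ hu m s)]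
    have := Measure.eqOn_Icc_of_ae_eq volume (S_lt_succ n).ne hae (hcont n).continuousOn
      ((hcont n).min (hcont m)).continuousOn hs
    exact this.trans_le (min_le_right _ _)
  have hmatch : ∀ n, f n (S (n + 1)) = f (n + 1) (S (n + 1)) := fun n =>
    le_antisymm (hmin n (n + 1) _ ⟨(S_lt_succ n).le, le_rfl⟩)
      (hmin (n + 1) n _ ⟨le_rfl, (S_lt_succ (n + 1)).le⟩)
  have hright : ∀ n s, a n ≤ s → f n s = -(s - a n) - u₁ (a n) - Δ (a n) * (s - a n) :=
    fun n s h => by simp only [hf, abs_of_nonneg (sub_nonneg.2 h)]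
  have hleft : ∀ n s, s ≤ a n → f n s = (s - a n) - u₁ (a n) - Δ (a n) * (s - a n) :=
    fun n s h => by simp only [hf, abs_of_nonpos (sub_nonpos.2 h), neg_neg]
  have hjump : ∀ n, Δ (a n) + 2 ≤ Δ (a (n + 1)) := by
    intro n
    have h1 := hmatch n
    have h2 := hmin n (n + 1) (a n) ⟨(S_lt_a n).le, (a_lt_S n).le⟩
    rw [hright n _ (a_lt_S n).le, hleft (n + 1) _ (S_lt_a (n + 1)).le] at h1
    rw [hright n _ le_rfl, hleft (n + 1) _ (a_strictMono n.lt_succ_self).le] at h2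
    have hl : 0 < S (n + 1) - a n := sub_pos.2 (a_lt_S n)
    refine le_of_mul_le_mul_right ?_ hl
    linarith
  have hgrow : ∀ n : ℕ, Δ (a 0) + 2 * n ≤ Δ (a n) := by
    intro n
    induction n with
    | zero => simp
    | succ n ih =>
      push_cast
      linarith [hjump n]
  have hstep : ∀ n, f (n + 1) (S (n + 2)) =
      f n (S (n + 1)) - Δ (a (n + 1)) * (1 / ((n : ℝ) + 2) ^ 2) := by
    intro n
    have h := S_succ (n + 1)
    have h2 : ((n + 1 : ℕ) : ℝ) + 1 = n + 2 := by push_cast; ring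
    rw [h2] at h
    rw [hmatch n, hleft (n + 1) _ (S_lt_a (n + 1)).le, hright (n + 1) _ (a_lt_S (n + 1)).le]
    have h3 : a (n + 1) = (S (n + 1) + S (n + 2)) / 2 := rfl
    rw [h3, h]
    ring
  obtain ⟨K, hK⟩ := exists_nat_ge (-Δ (a 0))
  have hlarge : ∀ n, K ≤ n → (n : ℝ) ≤ Δ (a n) := fun n hn => by
    have : (K : ℝ) ≤ n := by exact_mod_cast hn
    linarith [hgrow n]
  have hbound : ∀ n, K ≤ n → u₂ 2 ≤ f n (S (n + 1)) := by
    intro n hn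
    have h1 := hu n 2
    have h2 : S (n + 1) < 2 := (S_lt_limit _).trans limit_lt_two
    rw [hright n _ ((a_lt_S n).trans h2).le] at h1
    rw [hright n _ (a_lt_S n).le]
    have h3 : (0 : ℝ) ≤ n := Nat.cast_nonneg n
    have h4 := mul_nonneg (h3.trans (hlarge n hn)) (sub_nonneg.2 h2.le)
    linarith
  set H : ℕ → ℝ := fun n => ∑ i ∈ Finset.range n, 1 / ((i : ℝ) + 1) with hH
  have hdecr : ∀ n, K ≤ n →
      f n (S (n + 1)) + H (n + 2) / 4 ≤ f K (S (K + 1)) + H (K + 2) / 4 := by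
    intro n hn
    induction n, hn using Nat.le_induction with
    | base => exact le_rfl
    | succ n hn ih =>
      refine le_trans ?_ ih
      have h1 : H (n + 3) = H (n + 2) + 1 / ((n : ℝ) + 3) := by
        simp only [hH]
        rw [Finset.sum_range_succ]
        push_cast
        ring
      have h2 := hlarge (n + 1) (by omega)
      push_cast at h2
      have h3 : 1 / ((n : ℝ) + 3) / 4 ≤ Δ (a (n + 1)) * (1 / ((n : ℝ) + 2) ^ 2) := by
        refine le_trans ?_ (mul_le_mul_of_nonneg_right h2 (by positivity))
        rw [div_div, mul_one_div, div_le_div_iff₀ (by positivity) (by positivity)]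
        have : (0 : ℝ) ≤ n := Nat.cast_nonneg n
        nlinarith
      have h4 := hstep n
      rw [show n + 1 + 1 = n + 2 from rfl, show n + 1 + 2 = n + 3 from rfl, h4, h1]
      linarith
  have hH_top : Filter.Tendsto (fun n => H (n + 2)) Filter.atTop Filter.atTop :=
    Real.tendsto_sum_range_one_div_nat_succ_atTop.comp (Filter.tendsto_add_atTop_nat 2)
  obtain ⟨n, hn, hKn⟩ := ((hH_top.eventually_gt_atTop
    (4 * (f K (S (K + 1)) + H (K + 2) / 4 - u₂ 2))).and (Filter.eventually_ge_atTop K)).exists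
  linarith [hdecr n hKn, hbound n hKn]

end CounterEx

namespace CounterEx

/-- The slack in the subhedging inequality for the payoff `-|s₂ - s₁|`. -/
def gap (u₁ u₂ Δ : ℝ → ℝ) (p : ℝ × ℝ) : ℝ :=
  -|p.2 - p.1| - (u₁ p.1 + u₂ p.2 + Δ p.1 * (p.2 - p.1))

lemma integrable_Q_payoff : Integrable (fun p : ℝ × ℝ => -|p.2 - p.1|) Q := by
  have h := integrable_Q_mul_sub (Δ := fun _ => 1) measurable_const ⟨1, by simp⟩
  simp only [one_mul] at h
  exact h.abs.neg

lemma integrable_gap {u₁ u₂ Δ : ℝ → ℝ} (h₁ : Integrable u₁ μ₁) (h₂ : Integrable u₂ μ₂)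
    (hΔ : Measurable Δ) (hb : ∃ C, ∀ x, |Δ x| ≤ C) : Integrable (gap u₁ u₂ Δ) Q := by
  rw [← map_fst_Q] at h₁
  rw [← map_snd_Q] at h₂
  exact integrable_Q_payoff.sub (((h₁.comp_measurable measurable_fst).add
    (h₂.comp_measurable measurable_snd)).add (integrable_Q_mul_sub hΔ hb))

lemma integral_add_integral_eq {u₁ u₂ Δ : ℝ → ℝ} (h₁ : Integrable u₁ μ₁)
    (h₂ : Integrable u₂ μ₂) (hΔ : Measurable Δ) (hb : ∃ C, ∀ x, |Δ x| ≤ C) :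
    ∫ s, u₁ s ∂μ₁ + ∫ s, u₂ s ∂μ₂ =
      ∫ p : ℝ × ℝ, -|p.2 - p.1| ∂Q - ∫ p, gap u₁ u₂ Δ p ∂Q := by
  have hgap := integrable_gap h₁ h₂ hΔ hb
  rw [← map_fst_Q] at h₁ ⊢
  rw [← map_snd_Q] at h₂ ⊢
  have hm := isMartingaleCoupling_Q.2.2.2 Δ hΔ hb
  have h₁' : Integrable (fun p : ℝ × ℝ => u₁ p.1) Q := h₁.comp_measurable measurable_fst
  have h₂' : Integrable (fun p : ℝ × ℝ => u₂ p.2) Q := h₂.comp_measurable measurable_snd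
  have h₁₂ : Integrable (fun p : ℝ × ℝ => u₁ p.1 + u₂ p.2) Q := h₁'.add h₂'
  rw [integral_map measurable_fst.aemeasurable h₁.1, integral_map measurable_snd.aemeasurable h₂.1,
    ← integral_sub integrable_Q_payoff hgap, ← integral_add h₁' h₂', ← add_zero (∫ _, _ ∂Q), ← hm,
    ← integral_add h₁₂ (integrable_Q_mul_sub hΔ hb)]
  congr 1
  ext p
  simp only [gap]
  ring

lemma integrable_μ₁_of_continuous {f : ℝ → ℝ} (hf : Continuous f) : Integrable f μ₁ := by
  have := isProbabilityMeasure_Q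
  obtain ⟨C, hC⟩ := isCompact_Icc.exists_bound_of_continuousOn (s := Set.Icc (0 : ℝ) 2)
    hf.continuousOn
  rw [← map_fst_Q, integrable_map_measure hf.aestronglyMeasurable measurable_fst.aemeasurable]
  refine Integrable.of_bound (hf.comp continuous_fst).aestronglyMeasurable C ?_
  filter_upwards [ae_Q_mem_Icc] with p hp using hC _ hp.1

lemma integrable_μ₂_of_continuous {f : ℝ → ℝ} (hf : Continuous f) : Integrable f μ₂ :=
  (hf.continuousOn.integrableOn_Icc).smul_measure ENNReal.ofReal_ne_top

/-- Points that are not among the first `N` atoms `a 0, …, a (N - 1)`. -/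
def notAtom (N : ℕ) : Set ℝ := (a '' Set.Iio N)ᶜ

/-- First component of the `N`-th element of a maximizing sequence for the dual problem. -/
def approxU₁ (N : ℕ) (s : ℝ) : ℝ :=
  (-s + 2 * ∑ j ∈ Finset.range N, max (s - a j) 0) -
    (notAtom N).indicator (fun s => 2 * max (abar - s) 0) s

/-- Second component of the `N`-th element of a maximizing sequence for the dual problem. -/
def approxU₂ (N : ℕ) (s : ℝ) : ℝ :=
  s - 2 * ∑ j ∈ Finset.range N, max (s - a j) 0 - 2 * max (s - abar) 0

/-- Trading strategy of the `N`-th element of a maximizing sequence for the dual problem. -/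
def approxΔ (N : ℕ) (s : ℝ) : ℝ := 2 * ∑ j ∈ Finset.range N, if a j < s then 1 else 0

lemma measurableSet_notAtom (N : ℕ) : MeasurableSet (notAtom N) :=
  ((Set.finite_Iio N).image a).measurableSet.compl

lemma integrable_approxU₁ (N : ℕ) : Integrable (approxU₁ N) μ₁ := by
  refine Integrable.sub (integrable_μ₁_of_continuous (by fun_prop)) ?_
  exact (integrable_μ₁_of_continuous (by fun_prop)).indicator (measurableSet_notAtom N)

lemma integrable_approxU₂ (N : ℕ) : Integrable (approxU₂ N) μ₂ :=
  integrable_μ₂_of_continuous (by unfold approxU₂; fun_prop)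

lemma measurable_approxΔ (N : ℕ) : Measurable (approxΔ N) := by
  unfold approxΔ
  refine (Finset.measurable_fun_sum _ fun j _ => ?_).const_mul 2
  exact Measurable.ite measurableSet_Ioi measurable_const measurable_const

lemma approxΔ_bounded (N : ℕ) : ∃ C, ∀ x, |approxΔ N x| ≤ C := by
  refine ⟨2 * N, fun x => ?_⟩
  have h0 : (0 : ℝ) ≤ ∑ j ∈ Finset.range N, if a j < x then 1 else 0 :=
    Finset.sum_nonneg fun j _ => by split_ifs <;> norm_num
  have h1 : (∑ j ∈ Finset.range N, if a j < x then (1 : ℝ) else 0) ≤ N := by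
    calc _ ≤ ∑ j ∈ Finset.range N, (1 : ℝ) :=
          Finset.sum_le_sum fun j _ => by split_ifs <;> norm_num
      _ = N := by simp
  rw [approxΔ, abs_of_nonneg (by positivity)]
  linarith

/-- The excess at `y` of `(· - b)⁺` over a supporting line at `x`. -/
def hingeExcess (b x y : ℝ) : ℝ := if b < x then max (b - y) 0 else max (y - b) 0

lemma hingeExcess_nonneg (b x y : ℝ) : 0 ≤ hingeExcess b x y := by
  unfold hingeExcess
  split_ifs <;> exact le_max_right _ _

lemma hingeExcess_eq (b x y : ℝ) :
    hingeExcess b x y =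
      max (y - b) 0 - max (x - b) 0 - (if b < x then 1 else 0) * (y - x) := by
  unfold hingeExcess
  split_ifs with h
  · rw [max_eq_left (by linarith : 0 ≤ x - b)]
    rcases le_total b y with h' | h'
    · rw [max_eq_right (by linarith), max_eq_left (by linarith)]
      ring
    · rw [max_eq_left (by linarith), max_eq_right (by linarith)]
      ring
  · rw [max_eq_right (by linarith : x - b ≤ 0)]
    ring

/-- The slack of the `N`-th approximate dual optimizer. -/
def approxGap (N : ℕ) : ℝ × ℝ → ℝ := gap (approxU₁ N) (approxU₂ N) (approxΔ N)

lemma approxGap_eq (N : ℕ) (x y : ℝ) :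
    approxGap N (x, y) =
      2 * ∑ j ∈ Finset.range N, hingeExcess (a j) x y + 2 * max (y - abar) 0 - 2 * max (y - x) 0 +
        (notAtom N).indicator (fun s => 2 * max (abar - s) 0) x := by
  have h : |y - x| = 2 * max (y - x) 0 - (y - x) := by
    rcases le_total x y with h | h
    · rw [abs_of_nonneg (by linarith), max_eq_left (by linarith)]
      ring
    · rw [abs_of_nonpos (by linarith), max_eq_right (by linarith)]
      ring
  simp only [approxGap, gap, approxU₁, approxU₂, approxΔ, hingeExcess_eq, Finset.sum_sub_distrib,
    ← Finset.sum_mul, h]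
  ring

lemma notMem_notAtom {N k : ℕ} (hk : k < N) : a k ∉ notAtom N := by
  simp only [notAtom, Set.mem_compl_iff, not_not]
  exact ⟨k, hk, rfl⟩

lemma mem_notAtom_of_le {N n : ℕ} (hn : N ≤ n) : a n ∈ notAtom N := by
  rintro ⟨k, hk, h⟩
  have := a_strictMono.injective h
  simp only [Set.mem_Iio] at hk
  omega

lemma abar_mem_notAtom (N : ℕ) : abar ∈ notAtom N := by
  rintro ⟨k, -, h⟩
  exact ((a_lt_limit k).trans limit_lt_abar).ne h

lemma approxGap_nonneg (N : ℕ) (p : ℝ × ℝ) : 0 ≤ approxGap N p := by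
  obtain ⟨x, y⟩ := p
  rw [approxGap_eq]
  by_cases hx : x ∈ notAtom N
  · have h1 : 0 ≤ ∑ j ∈ Finset.range N, hingeExcess (a j) x y :=
      Finset.sum_nonneg fun j _ => hingeExcess_nonneg _ _ _
    have h2 : max (y - x) 0 ≤ max (y - abar) 0 + max (abar - x) 0 := by
      refine max_le ?_ (add_nonneg (le_max_right _ _) (le_max_right _ _))
      linarith [le_max_left (y - abar) 0, le_max_left (abar - x) 0]
    rw [Set.indicator_of_mem hx]
    linarith
  · rw [Set.indicator_of_notMem hx]
    simp only [notAtom, Set.mem_compl_iff, not_not] at hx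
    obtain ⟨k, hk, rfl⟩ := hx
    have h1 : hingeExcess (a k) (a k) y ≤ ∑ j ∈ Finset.range N, hingeExcess (a j) (a k) y :=
      Finset.single_le_sum (f := fun j => hingeExcess (a j) (a k) y)
        (fun j _ => hingeExcess_nonneg _ _ _) (Finset.mem_range.2 hk)
    rw [hingeExcess, if_neg (lt_irrefl _)] at h1
    linarith [le_max_right (y - abar) 0]

lemma hingeExcess_a_eq_zero {j n : ℕ} (hjn : j ≠ n) {s : ℝ}
    (hs : s ∈ Set.Icc (S n) (S (n + 1))) : hingeExcess (a j) (a n) s = 0 := by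
  unfold hingeExcess
  rcases lt_or_gt_of_ne hjn with h | h
  · rw [if_pos (a_strictMono h), max_eq_right]
    linarith [hs.1, a_lt_S j, S_strictMono.monotone (show j + 1 ≤ n from h)]
  · rw [if_neg (a_strictMono h).le.not_gt, max_eq_right]
    linarith [hs.2, S_lt_a j, S_strictMono.monotone (show n + 1 ≤ j from h)]

lemma max_sub_abar_eq_zero {n : ℕ} {s : ℝ} (hs : s ∈ Set.Icc (S n) (S (n + 1))) :
    max (s - abar) 0 = 0 :=
  max_eq_right (by linarith [hs.2, S_lt_limit (n + 1), limit_lt_abar])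

lemma approxGap_a_of_lt {N n : ℕ} (hn : n < N) {s : ℝ} (hs : s ∈ Set.Icc (S n) (S (n + 1))) :
    approxGap N (a n, s) = 0 := by
  rw [approxGap_eq, Set.indicator_of_notMem (notMem_notAtom hn), max_sub_abar_eq_zero hs,
    Finset.sum_eq_single_of_mem n (Finset.mem_range.2 hn)
      fun j _ hj => hingeExcess_a_eq_zero hj hs, hingeExcess, if_neg (lt_irrefl _)]
  ring

lemma approxGap_a_le (N n : ℕ) {s : ℝ} (hs : s ∈ Set.Icc (S n) (S (n + 1))) :
    approxGap N (a n, s) ≤ 4 := by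
  rcases lt_or_ge n N with hn | hn
  · rw [approxGap_a_of_lt hn hs]
    norm_num
  · rw [approxGap_eq, Set.indicator_of_mem (mem_notAtom_of_le hn), max_sub_abar_eq_zero hs,
      Finset.sum_eq_zero fun j hj =>
        hingeExcess_a_eq_zero ((Finset.mem_range.1 hj).trans_le hn).ne hs,
      max_eq_left (by linarith [a_lt_limit n, limit_lt_abar] : 0 ≤ abar - a n)]
    linarith [le_max_right (s - a n) 0, abar_lt_two, S_nonneg n, S_lt_a n]

lemma approxGap_abar (N : ℕ) {s : ℝ} (hs : s ∈ Set.Icc (Real.pi ^ 2 / 6) 2) :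
    approxGap N (abar, s) = 0 := by
  rw [approxGap_eq, Set.indicator_of_mem (abar_mem_notAtom N), Finset.sum_eq_zero]
  · simp
  · intro j _
    rw [hingeExcess, if_pos ((a_lt_limit j).trans limit_lt_abar), max_eq_right]
    linarith [hs.1, a_lt_limit j]

lemma tendsto_integral_approxGap :
    Filter.Tendsto (fun N => ∫ p, approxGap N p ∂Q) Filter.atTop (nhds 0) := by
  have := isProbabilityMeasure_Q
  have h := tendsto_integral_of_dominated_convergence (μ := Q) (F := approxGap)
    (f := fun _ => (0 : ℝ)) (fun _ => 4)
    (fun N => (integrable_gap (integrable_approxU₁ N) (integrable_approxU₂ N)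
      (measurable_approxΔ N) (approxΔ_bounded N)).1) (integrable_const _) ?_ ?_
  · simpa using h
  · intro N
    refine ae_Q_of_forall (fun n s hs => ?_) (fun s hs => ?_)
    · rw [Real.norm_of_nonneg (approxGap_nonneg N _)]
      exact approxGap_a_le N n hs
    · rw [approxGap_abar N hs]
      norm_num
  · refine ae_Q_of_forall (fun n s hs => ?_) (fun s hs => ?_)
    · refine tendsto_const_nhds.congr' ?_
      filter_upwards [Filter.eventually_gt_atTop n] with N hN
      rw [approxGap_a_of_lt hN hs]
    · simp [approxGap_abar _ hs]

lemma approx_admissible (N : ℕ) (s₁ s₂ : ℝ) :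
    approxU₁ N s₁ + approxU₂ N s₂ + approxΔ N s₁ * (s₂ - s₁) ≤ -|s₂ - s₁| :=
  sub_nonneg.1 (approxGap_nonneg N (s₁, s₂))

end CounterEx

open CounterEx in
/-- **Proposition 4.1 (non-existence of dual maximizers).** For the measures `μ₁, μ₂`
above (with `Q` the unique element of `M(μ₁, μ₂)`) and the payoff `Φ(s₁,s₂) = -|s₂ - s₁|`,
there are no functions `u₁, u₂, Δ : ℝ → ℝ` with
`u₁(s₁) + u₂(s₂) + Δ(s₁)(s₂ - s₁) ≤ -|s₂ - s₁|` everywhere and equality `Q`-almost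
surely. In particular the dual value `D` is finite but the dual supremum is not
attained. -/
theorem dual_not_attained :
    (¬ ∃ u₁ u₂ Δ : ℝ → ℝ,
        (∀ s₁ s₂ : ℝ, u₁ s₁ + u₂ s₂ + Δ s₁ * (s₂ - s₁) ≤ -|s₂ - s₁|) ∧
        (∀ᵐ p : ℝ × ℝ ∂Q, u₁ p.1 + u₂ p.2 + Δ p.1 * (p.2 - p.1) = -|p.2 - p.1|)) ∧
    sSup {v : EReal | ∃ u₁ u₂ Δ : ℝ → ℝ,
        Integrable u₁ μ₁ ∧ Integrable u₂ μ₂ ∧ Measurable Δ ∧ (∃ C, ∀ x, |Δ x| ≤ C) ∧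
        (∀ s₁ s₂ : ℝ, u₁ s₁ + u₂ s₂ + Δ s₁ * (s₂ - s₁) ≤ -|s₂ - s₁|) ∧
        v = ((∫ s, u₁ s ∂μ₁ + ∫ s, u₂ s ∂μ₂ : ℝ) : EReal)} ≠ ⊥ ∧
    sSup {v : EReal | ∃ u₁ u₂ Δ : ℝ → ℝ,
        Integrable u₁ μ₁ ∧ Integrable u₂ μ₂ ∧ Measurable Δ ∧ (∃ C, ∀ x, |Δ x| ≤ C) ∧
        (∀ s₁ s₂ : ℝ, u₁ s₁ + u₂ s₂ + Δ s₁ * (s₂ - s₁) ≤ -|s₂ - s₁|) ∧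
        v = ((∫ s, u₁ s ∂μ₁ + ∫ s, u₂ s ∂μ₂ : ℝ) : EReal)} ≠ ⊤ ∧
    sSup {v : EReal | ∃ u₁ u₂ Δ : ℝ → ℝ,
        Integrable u₁ μ₁ ∧ Integrable u₂ μ₂ ∧ Measurable Δ ∧ (∃ C, ∀ x, |Δ x| ≤ C) ∧
        (∀ s₁ s₂ : ℝ, u₁ s₁ + u₂ s₂ + Δ s₁ * (s₂ - s₁) ≤ -|s₂ - s₁|) ∧
        v = ((∫ s, u₁ s ∂μ₁ + ∫ s, u₂ s ∂μ₂ : ℝ) : EReal)} ∉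
      {v : EReal | ∃ u₁ u₂ Δ : ℝ → ℝ,
        Integrable u₁ μ₁ ∧ Integrable u₂ μ₂ ∧ Measurable Δ ∧ (∃ C, ∀ x, |Δ x| ≤ C) ∧
        (∀ s₁ s₂ : ℝ, u₁ s₁ + u₂ s₂ + Δ s₁ * (s₂ - s₁) ≤ -|s₂ - s₁|) ∧
        v = ((∫ s, u₁ s ∂μ₁ + ∫ s, u₂ s ∂μ₂ : ℝ) : EReal)} := by
  refine ⟨not_exists_pointwise_optimizer, ?_, ?_, ?_⟩
  · refine ne_bot_of_le_ne_bot (EReal.coe_ne_bot _) (le_sSup ⟨approxU₁ 0, approxU₂ 0, approxΔ 0,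
      integrable_approxU₁ 0, integrable_approxU₂ 0, measurable_approxΔ 0, approxΔ_bounded 0,
      approx_admissible 0, rfl⟩)
  · refine ne_top_of_le_ne_top (EReal.coe_ne_top (∫ p : ℝ × ℝ, -|p.2 - p.1| ∂Q)) (sSup_le ?_)
    rintro v ⟨u₁, u₂, Δ, h₁, h₂, hΔ, hb, hle, rfl⟩
    rw [EReal.coe_le_coe_iff, integral_add_integral_eq h₁ h₂ hΔ hb]
    have : 0 ≤ ∫ p, gap u₁ u₂ Δ p ∂Q := integral_nonneg fun p => sub_nonneg.2 (hle p.1 p.2)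
    linarith
  · rintro ⟨u₁, u₂, Δ, h₁, h₂, hΔ, hb, hle, hv⟩
    have hnonneg : 0 ≤ gap u₁ u₂ Δ := fun p => sub_nonneg.2 (hle p.1 p.2)
    have hgap : ∀ N, ∫ p, gap u₁ u₂ Δ p ∂Q ≤ ∫ p, approxGap N p ∂Q := by
      intro N
      have h : ((∫ s, approxU₁ N s ∂μ₁ + ∫ s, approxU₂ N s ∂μ₂ : ℝ) : EReal) ≤
          ((∫ s, u₁ s ∂μ₁ + ∫ s, u₂ s ∂μ₂ : ℝ) : EReal) := by
        rw [← hv]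
        exact le_sSup ⟨approxU₁ N, approxU₂ N, approxΔ N, integrable_approxU₁ N,
          integrable_approxU₂ N, measurable_approxΔ N, approxΔ_bounded N, approx_admissible N, rfl⟩
      rw [EReal.coe_le_coe_iff, integral_add_integral_eq h₁ h₂ hΔ hb,
        integral_add_integral_eq (integrable_approxU₁ N) (integrable_approxU₂ N)
          (measurable_approxΔ N) (approxΔ_bounded N)] at h
      unfold approxGap
      linarith
    have hzero : ∫ p, gap u₁ u₂ Δ p ∂Q = 0 :=
      le_antisymm (ge_of_tendsto' tendsto_integral_approxGap hgap) (integral_nonneg hnonneg)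
    rw [integral_eq_zero_iff_of_nonneg hnonneg (integrable_gap h₁ h₂ hΔ hb)] at hzero
    refine not_exists_pointwise_optimizer ⟨u₁, u₂, Δ, hle, ?_⟩
    filter_upwards [hzero] with p hp
    exact (sub_eq_zero.1 hp).symm
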